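/- For n ∈ ℕ define the triangle-wave function φ_n : [0,1] → ℝ by φ_n(x) := (1/2) ∑_{i=0}^n (−1)^i max(0, 1/n − |x − i/n|). Then φ_n is differentiable at every x ∈ [0,1] with nx ∉ ℤ, its derivative satisfies φ_n'(x)² = 1 at all such points, and ∑_{i=−n}^{n} (−1)^i ∫_{max(0, i/n)}^{min(1, 1 + i/n)} φ_n'(x) · φ_n'(x − i/n) dx = n. -/

import Mathlib

open MeasureTheory Filter Set

namespace Paper

variable {d : ℕ}

/-- The closed unit cube `[0,1]^d`. -/
def cubeIcc (d : ℕ) : Set (Fin d → ℝ) := Set.Icc 0 1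

/-- The half-open cube `[0,1)^d`. -/
def cubeIco (d : ℕ) : Set (Fin d → ℝ) := Set.univ.pi fun _ => Set.Ico (0:ℝ) 1

/-- The open cube `(0,1)^d`. -/
def cubeIoo (d : ℕ) : Set (Fin d → ℝ) := Set.univ.pi fun _ => Set.Ioo (0:ℝ) 1

/-- The sign `(−1)^{⟨v,w⟩}` for `v, w ∈ {0,1}^d`. -/
def sgn (v w : Fin d → Bool) : ℝ :=
  (-1) ^ (Finset.univ.filter fun i => v i = true ∧ w i = true).card

/-- `|v|`, the number of nonzero entries of `v ∈ {0,1}^d`. -/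
def wt (v : Fin d → Bool) : ℕ := (Finset.univ.filter fun i => v i = true).card

/-- The vector `h^w = h·((−1)^{w_1},…,(−1)^{w_d})`. -/
def shiftVec (h : ℝ) (w : Fin d → Bool) : Fin d → ℝ := fun i => if w i then -h else h

/-- The discrete Fourier difference `Δ_h^v f (x) = 2^{-d} ∑_w (−1)^{⟨v,w⟩} f(x + h^w)`. -/
noncomputable def dfourier (f : (Fin d → ℝ) → ℝ) (v : Fin d → Bool) (h : ℝ)
    (x : Fin d → ℝ) : ℝ :=
  (1 / 2 ^ d) * ∑ w : Fin d → Bool, sgn v w * f (x + shiftVec h w)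

/-- The partial derivative in direction `i`. -/
noncomputable def pderivI (i : Fin d) (f : (Fin d → ℝ) → ℝ) : (Fin d → ℝ) → ℝ :=
  fun x => fderiv ℝ f x (Pi.single i 1)

/-- The mixed partial derivative `D^v f = (∂/∂x_1)^{v_1} ⋯ (∂/∂x_d)^{v_d} f`. -/
noncomputable def Dmixed (v : Fin d → Bool) (f : (Fin d → ℝ) → ℝ) : (Fin d → ℝ) → ℝ :=
  (List.finRange d).foldr (fun i g => cond (v i) (pderivI i g) g) f

/-- The Kuhn simplex `S_σ = {x ∈ [0,1]^d : x_{σ(1)} ≤ … ≤ x_{σ(d)}}`. -/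
def KuhnSimplex (σ : Equiv.Perm (Fin d)) : Set (Fin d → ℝ) :=
  {x | x ∈ cubeIcc d ∧ ∀ i j : Fin d, i ≤ j → x (σ i) ≤ x (σ j)}

/-- A continuous function on the cube is smooth on simplices if its restriction to each
Kuhn simplex extends to a `C^∞` function on an open neighbourhood of the simplex. -/
def SmoothOnSimplices (f : (Fin d → ℝ) → ℝ) : Prop :=
  ContinuousOn f (cubeIcc d) ∧
  ∀ σ : Equiv.Perm (Fin d), ∃ (U : Set (Fin d → ℝ)) (g : (Fin d → ℝ) → ℝ),
    IsOpen U ∧ KuhnSimplex σ ⊆ U ∧ ContDiffOn ℝ (⊤ : ℕ∞) g U ∧ Set.EqOn f g (KuhnSimplex σ)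

/-- The centre `x̃^{(n)}` of the lattice cell of side `1/n` containing `x`. -/
noncomputable def latticeCenter (n : ℕ) (x : Fin d → ℝ) : Fin d → ℝ :=
  fun i => (⌊(n : ℝ) * x i⌋ : ℝ) / n + 1 / (2 * n)

/-- The `n`-th lattice approximation `Δ̃_n^v f (x) = Δ_{1/(2n)}^v f (x̃^{(n)})`. -/
noncomputable def latticeDelta (n : ℕ) (f : (Fin d → ℝ) → ℝ) (v : Fin d → Bool)
    (x : Fin d → ℝ) : ℝ :=
  dfourier f v (1 / (2 * n)) (latticeCenter n x)

/-- `f` has generalised differential `L` at `x` to `v` in degree `α`. -/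
def HasGenDeriv (f : (Fin d → ℝ) → ℝ) (v : Fin d → Bool) (α : ℕ)
    (x : Fin d → ℝ) (L : ℝ) : Prop :=
  Tendsto (fun h : ℝ => (1 / h ^ α) * dfourier f v h x) (nhdsWithin 0 (Set.Ioi 0)) (nhds L)

/-- The generalised differential `D_α^v f(x)` (the value of the limit when it exists). -/
noncomputable def genDeriv (f : (Fin d → ℝ) → ℝ) (v : Fin d → Bool) (α : ℕ)
    (x : Fin d → ℝ) : ℝ :=
  limUnder (nhdsWithin 0 (Set.Ioi 0)) fun h : ℝ => (1 / h ^ α) * dfourier f v h x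

/-- `x` has coincidence partition given by the fibres of the surjection `p`,
i.e. `d(x) = 𝒫` where `𝒫` is the partition of `{1,…,d}` into the fibres of `p`. -/
def CoincWith (x : Fin d → ℝ) {k : ℕ} (p : Fin d → Fin k) : Prop :=
  ∀ i j, x i = x j ↔ p i = p j

/-- The generalised diagonal `𝒟_𝒫 = {x ∈ (0,1)^d : d(x) = 𝒫}`. -/
def diagP {k : ℕ} (p : Fin d → Fin k) : Set (Fin d → ℝ) :=
  {x | x ∈ cubeIoo d ∧ CoincWith x p}

/-- `α(𝒫,v)`: the number of blocks of `𝒫` containing an index `a` with `v_a = 1`. -/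
def alphaP {k : ℕ} (p : Fin d → Fin k) (v : Fin d → Bool) : ℕ :=
  ((Finset.univ.filter fun i => v i = true).image p).card

/-- The triangle-wave function `φ_n(x) = (1/2) ∑_{i=0}^n (−1)^i max(0, 1/n − |x − i/n|)`. -/
noncomputable def triWave (n : ℕ) (x : ℝ) : ℝ :=
  (1 / 2) * ∑ i ∈ Finset.range (n + 1), (-1 : ℝ) ^ i * max 0 (1 / n - |x - i / n|)

lemma triWave_local (n k : ℕ) (hn : 0 < n) (hk : k < n) (x : ℝ) (h1 : (k : ℝ) < n * x)
    (h2 : (n : ℝ) * x < k + 1) :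
    triWave n x = -(-1 : ℝ) ^ k * x + (-1 : ℝ) ^ k * ((2 * k + 1) / (2 * n)) := by
  have hn' : (0 : ℝ) < n := by exact_mod_cast hn
  have hterm : ∀ i : ℕ, 1 / (n : ℝ) - |x - i / n| = (1 - |n * x - i|) / n := by
    intro i
    have : x - i / n = (n * x - i) / n := by field_simp
    rw [this, abs_div, abs_of_pos hn', sub_div]
  unfold triWave
  rw [← Finset.sum_subset (s₁ := {k, k + 1})]
  · rw [Finset.sum_pair (by omega), hterm, hterm, abs_of_pos (by linarith),
      abs_of_neg (by push_cast; linarith), max_eq_right, max_eq_right]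
    · push_cast
      field_simp
      ring
    · push_cast
      apply div_nonneg _ hn'.le
      linarith
    · apply div_nonneg _ hn'.le
      linarith
  · intro i hi
    simp only [Finset.mem_insert, Finset.mem_singleton, Finset.mem_range] at *
    omega
  · intro i hi hi2
    simp only [Finset.mem_insert, Finset.mem_singleton, not_or] at hi2
    rw [hterm, max_eq_left, mul_zero]
    apply div_nonpos_of_nonpos_of_nonneg _ hn'.le
    have : i + 1 ≤ k ∨ k + 2 ≤ i := by omega
    rcases this with h | h
    · have h' : (i : ℝ) + 1 ≤ k := by exact_mod_cast h
      have := le_abs_self (n * x - i)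
      linarith
    · have h' : (k : ℝ) + 2 ≤ i := by exact_mod_cast h
      have := neg_abs_le (n * x - i)
      linarith

lemma triWave_hasDerivAt (n k : ℕ) (hn : 0 < n) (hk : k < n) (x : ℝ) (h1 : (k : ℝ) < n * x)
    (h2 : (n : ℝ) * x < k + 1) : HasDerivAt (triWave n) (-(-1 : ℝ) ^ k) x := by
  have hd : HasDerivAt (fun y : ℝ => -(-1 : ℝ) ^ k * y + (-1 : ℝ) ^ k * ((2 * k + 1) / (2 * n)))
      (-(-1 : ℝ) ^ k) x := by
    simpa using ((hasDerivAt_id x).const_mul (-(-1 : ℝ) ^ k)).add_const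
      ((-1 : ℝ) ^ k * ((2 * k + 1) / (2 * n)))
  apply hd.congr_of_eventuallyEq
  have hc : Continuous fun y : ℝ => (n : ℝ) * y := by fun_prop
  filter_upwards [hc.continuousAt.eventually (lt_mem_nhds h1),
    hc.continuousAt.eventually (gt_mem_nhds h2)] with y hy1 hy2
  exact triWave_local n k hn hk y hy1 hy2

lemma cell_exists (n : ℕ) (x : ℝ) (hx : x ∈ Set.Icc (0 : ℝ) 1)
    (hx2 : ¬ ∃ m : ℤ, (n : ℝ) * x = (m : ℝ)) :
    ∃ k : ℕ, k < n ∧ (k : ℝ) < n * x ∧ (n : ℝ) * x < k + 1 := by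
  have h0 : (0 : ℝ) ≤ n * x := mul_nonneg (Nat.cast_nonneg n) hx.1
  have hlt : ((⌊(n : ℝ) * x⌋₊ : ℕ) : ℝ) < n * x := by
    apply lt_of_le_of_ne (Nat.floor_le h0)
    intro h
    exact hx2 ⟨(⌊(n : ℝ) * x⌋₊ : ℕ), by rw [Int.cast_natCast, h]⟩
  refine ⟨⌊(n : ℝ) * x⌋₊, ?_, hlt, Nat.lt_floor_add_one _⟩
  have : (n : ℝ) * x ≤ n := mul_le_of_le_one_right (Nat.cast_nonneg n) hx.2
  exact_mod_cast hlt.trans_le this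

lemma prod_eq (n : ℕ) (hn : 0 < n) (i : ℤ) (x : ℝ) (hx : x ∈ Set.Icc (0 : ℝ) 1)
    (hx' : x - i / n ∈ Set.Icc (0 : ℝ) 1)
    (hx2 : ¬ ∃ m : ℤ, (n : ℝ) * x = (m : ℝ)) :
    deriv (triWave n) x * deriv (triWave n) (x - (i : ℝ) / n) = (-1 : ℝ) ^ i := by
  have hn' : (n : ℝ) ≠ 0 := by positivity
  have he : (n : ℝ) * (x - i / n) = n * x - i := by field_simp
  obtain ⟨k, hk, h1, h2⟩ := cell_exists n x hx hx2
  obtain ⟨l, hl, h3, h4⟩ := cell_exists n (x - i / n) hx' (by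
    rintro ⟨m, hm⟩
    exact hx2 ⟨m + i, by push_cast; linarith⟩)
  rw [(triWave_hasDerivAt n k hn hk x h1 h2).deriv, (triWave_hasDerivAt n l hn hl _ h3 h4).deriv]
  rw [he] at h3 h4
  have e1 : (k : ℤ) < l + i + 1 := by
    have : (k : ℝ) < l + i + 1 := by linarith
    exact_mod_cast this
  have e2 : (l : ℤ) + i < k + 1 := by
    have : (l : ℝ) + i < k + 1 := by linarith
    exact_mod_cast this
  have e : i = k - l := by omega
  rw [e, zpow_sub₀ (by norm_num), zpow_natCast, zpow_natCast]
  rcases neg_one_pow_eq_or ℝ l with h | h <;> rw [h] <;> simp [div_neg]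

lemma integral_eq (n : ℕ) (hn : 0 < n) (i : ℤ) (hi : i ∈ Finset.Icc (-(n : ℤ)) (n : ℤ)) :
    (-1 : ℝ) ^ i * ∫ x in (max 0 ((i : ℝ) / n))..(min 1 (1 + (i : ℝ) / n)),
            deriv (triWave n) x * deriv (triWave n) (x - (i : ℝ) / n) = 1 - |(i : ℝ)| / n := by
  have hn' : (0 : ℝ) < n := by exact_mod_cast hn
  rw [Finset.mem_Icc] at hi
  have hi1 : -(1 : ℝ) ≤ i / n := by
    rw [le_div_iff₀ hn']
    have : (-(n : ℤ) : ℝ) ≤ i := by exact_mod_cast hi.1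
    push_cast at this
    linarith
  have hi2 : (i : ℝ) / n ≤ 1 := by
    rw [div_le_one hn']
    exact_mod_cast hi.2
  have hle : max 0 ((i : ℝ) / n) ≤ min 1 (1 + (i : ℝ) / n) := by
    apply max_le <;> apply le_min <;> linarith
  have hcount : ((Set.range fun m : ℤ => (m : ℝ) / n)).Countable := Set.countable_range _
  have hae : ∀ᵐ x : ℝ, x ∉ Set.range fun m : ℤ => (m : ℝ) / n := by
    exact hcount.ae_notMem volume
  have hint : (∫ x in (max 0 ((i : ℝ) / n))..(min 1 (1 + (i : ℝ) / n)),
      deriv (triWave n) x * deriv (triWave n) (x - (i : ℝ) / n))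
      = ∫ x in (max 0 ((i : ℝ) / n))..(min 1 (1 + (i : ℝ) / n)), (-1 : ℝ) ^ i := by
    apply intervalIntegral.integral_congr_ae
    filter_upwards [hae] with x hx hm
    rw [Set.uIoc_of_le hle, Set.mem_Ioc, max_lt_iff, le_min_iff] at hm
    apply prod_eq n hn i x ⟨by linarith, by linarith⟩ ⟨by linarith, by linarith⟩
    rintro ⟨m, hm⟩
    exact hx ⟨m, by simp only; rw [← hm]; field_simp⟩
  rw [hint, intervalIntegral.integral_const, smul_eq_mul]
  have hs : (-1 : ℝ) ^ i * (-1 : ℝ) ^ i = 1 := by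
    rw [← mul_zpow]; norm_num
  have hlen : min 1 (1 + (i : ℝ) / n) - max 0 ((i : ℝ) / n) = 1 - |(i : ℝ)| / n := by
    rw [show |(i : ℝ)| / n = |(i : ℝ) / n| by rw [abs_div, abs_of_pos hn']]
    rcases le_total 0 ((i : ℝ) / n) with h | h
    · rw [min_eq_left (by linarith), max_eq_right h, abs_of_nonneg h]
    · rw [min_eq_right (by linarith), max_eq_left h, abs_of_nonpos h]; ring
  rw [hlen, mul_left_comm, hs, mul_one]

lemma sum_abs_Icc (n : ℕ) : ∑ i ∈ Finset.Icc (-(n : ℤ)) (n : ℤ), |(i : ℝ)| = n * (n + 1) := by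
  induction n with
  | zero => simp
  | succ n ih =>
    have : Finset.Icc (-((n + 1 : ℕ) : ℤ)) ((n + 1 : ℕ) : ℤ)
        = insert (-((n : ℤ) + 1)) (insert ((n : ℤ) + 1) (Finset.Icc (-(n : ℤ)) (n : ℤ))) := by
      ext j
      simp only [Finset.mem_insert, Finset.mem_Icc]
      omega
    have hp : (0 : ℝ) ≤ n + 1 := by positivity
    rw [this, Finset.sum_insert, Finset.sum_insert, ih]
    · push_cast
      rw [abs_neg, abs_of_nonneg hp]
      ring
    · simp
    · simp only [Finset.mem_insert, Finset.mem_Icc]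
      omega

/-- `φ_n` is differentiable at every `x ∈ [0,1]` with `nx ∉ ℤ`, there its
derivative satisfies `φ_n'(x)² = 1`, and
`∑_{i=−n}^{n} (−1)^i ∫_{max(0,i/n)}^{min(1,1+i/n)} φ_n'(x)·φ_n'(x − i/n) dx = n`. -/
theorem statement16 (n : ℕ) (hn : 0 < n) :
    (∀ x ∈ Set.Icc (0 : ℝ) 1, (¬ ∃ m : ℤ, (n : ℝ) * x = (m : ℝ)) →
      DifferentiableAt ℝ (triWave n) x) ∧
    (∀ x ∈ Set.Icc (0 : ℝ) 1, (¬ ∃ m : ℤ, (n : ℝ) * x = (m : ℝ)) →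
      (deriv (triWave n) x) ^ 2 = 1) ∧
    (∑ i ∈ Finset.Icc (-(n : ℤ)) (n : ℤ),
        (-1 : ℝ) ^ i *
          ∫ x in (max 0 ((i : ℝ) / n))..(min 1 (1 + (i : ℝ) / n)),
            deriv (triWave n) x * deriv (triWave n) (x - (i : ℝ) / n))
      = (n : ℝ) := by
  refine ⟨?_, ?_, ?_⟩
  · intro x hx hx2
    obtain ⟨k, hk, h1, h2⟩ := cell_exists n x hx hx2
    exact (triWave_hasDerivAt n k hn hk x h1 h2).differentiableAt
  · intro x hx hx2
    obtain ⟨k, hk, h1, h2⟩ := cell_exists n x hx hx2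
    rw [(triWave_hasDerivAt n k hn hk x h1 h2).deriv, neg_sq, ← pow_mul, mul_comm, pow_mul]
    norm_num
  · rw [Finset.sum_congr rfl (integral_eq n hn), Finset.sum_sub_distrib, ← Finset.sum_div,
      sum_abs_Icc]
    have hn' : (n : ℝ) ≠ 0 := by positivity
    have hc : ((n : ℤ) + 1 - -(n : ℤ)).toNat = 2 * n + 1 := by omega
    simp only [Finset.sum_const, Int.card_Icc, hc]
    push_cast
    field_simp
    push_cast
    ring

end Paper
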